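/- Low conductance of the union of two sparse cuts. Let G be a finite simple graph with vertex set V and let ψ > 0. Suppose Y, Z ⊆ V satisfy |δ_G(Y)| ≤ ψ·vol_G(Y), |δ_G(Z)| ≤ (ψ/3)·vol_G(Z), and vol_G(Z ∖ Y) ≥ (2/5)·vol_G(Z). Then |δ_G(Y ∪ Z)| ≤ ψ·vol_G(Y ∪ Z). -/

import Mathlib

open Finset

attribute [local instance] Classical.propDecidable

/-- The number of edges of `G` with exactly one endpoint in `W`, i.e. `|δ_G(W)|`. -/
noncomputable def cutSize {V : Type*} (G : SimpleGraph V) (W : Finset V) : ℕ :=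
  {e : Sym2 V | e ∈ G.edgeSet ∧ (∃ u ∈ e, u ∈ W) ∧ (∃ v ∈ e, v ∉ W)}.ncard

/-- The volume of `X`: the sum of the degrees of the vertices in `X`. -/
noncomputable def vol {V : Type*} [Fintype V] (G : SimpleGraph V) (X : Finset V) : ℕ :=
  ∑ v ∈ X, G.degree v

/-- The cut function is subadditive under unions. -/
theorem cutSize_union_le {V : Type*} [Finite V] (G : SimpleGraph V) (Y Z : Finset V) :
    cutSize G (Y ∪ Z) ≤ cutSize G Y + cutSize G Z := by
  refine (Set.ncard_le_ncard ?_ (Set.toFinite _)).trans (Set.ncard_union_le _ _)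
  rintro e ⟨he, ⟨u, hu, huYZ⟩, v, hv, hvYZ⟩
  rw [mem_union, not_or] at hvYZ
  rcases mem_union.1 huYZ with huY | huZ
  · exact Or.inl ⟨he, ⟨u, hu, huY⟩, v, hv, hvYZ.1⟩
  · exact Or.inr ⟨he, ⟨u, hu, huZ⟩, v, hv, hvYZ.2⟩

theorem vol_union {V : Type*} [Fintype V] (G : SimpleGraph V) (Y Z : Finset V) :
    vol G (Y ∪ Z) = vol G Y + vol G (Z \ Y) := by
  unfold vol
  rw [← sum_union disjoint_sdiff, union_sdiff_self_eq_union]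

/-- Low conductance of the union of two sparse cuts. -/
theorem union_of_sparse_cuts {V : Type*} [Fintype V] (G : SimpleGraph V) (ψ : ℝ)
    (hψ : 0 < ψ) (Y Z : Finset V)
    (hY : (cutSize G Y : ℝ) ≤ ψ * (vol G Y : ℝ))
    (hZ : (cutSize G Z : ℝ) ≤ (ψ / 3) * (vol G Z : ℝ))
    (hZY : (2 / 5 : ℝ) * (vol G Z : ℝ) ≤ (vol G (Z \ Y) : ℝ)) :
    (cutSize G (Y ∪ Z) : ℝ) ≤ ψ * (vol G (Y ∪ Z) : ℝ) := by
  have h_cut : (cutSize G (Y ∪ Z) : ℝ) ≤ cutSize G Y + cutSize G Z := by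
    exact_mod_cast cutSize_union_le G Y Z
  have h_third : (1 / 3 : ℝ) * vol G Z ≤ vol G (Z \ Y) := by
    have h_nonneg : (0 : ℝ) ≤ vol G Z := Nat.cast_nonneg _
    linarith
  have h_mul := mul_le_mul_of_nonneg_left h_third hψ.le
  rw [vol_union, Nat.cast_add, mul_add]
  linarith
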